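/- Let A and Â be real symmetric n×n matrices, let 1 ≤ r < n, let δ_r := λ_r(A) − λ_{r+1}(A) > 0, and let V ∈ O_{n,r} and V̂ ∈ O_{n,r} be top-r orthonormal eigenbases of A and of Â, respectively. If ‖Â − A‖₂ < δ_r/2, then ‖VVᵀ − V̂V̂ᵀ‖₂ ≤ 2‖(Â − A)V‖₂ / δ_r. -/

import Mathlib

open Matrix

/-- The spectral norm (ℓ²→ℓ² operator norm) of a real matrix. -/
noncomputable def sNorm {m n : ℕ} (A : Matrix (Fin m) (Fin n) ℝ) : ℝ :=
  ‖LinearMap.toContinuousLinearMap (Matrix.toEuclideanLin A)‖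


open scoped Matrix.Norms.L2Operator

lemma dk_sNorm_eq {m n : ℕ} (A : Matrix (Fin m) (Fin n) ℝ) : sNorm A = ‖A‖ := rfl

lemma dk_nsq {m : ℕ} (x : Fin m → ℝ) : ‖WithLp.toLp 2 x‖ ^ 2 = x ⬝ᵥ x := by
  rw [EuclideanSpace.norm_sq_eq]
  simp [dotProduct, sq]

lemma dk_mulVec_le {m n : ℕ} (A : Matrix (Fin m) (Fin n) ℝ) (x : Fin n → ℝ) :
    (A *ᵥ x) ⬝ᵥ (A *ᵥ x) ≤ ‖A‖ ^ 2 * (x ⬝ᵥ x) := by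
  have h := Matrix.l2_opNorm_mulVec A (WithLp.toLp 2 x)
  rw [← dk_nsq, ← dk_nsq, ← mul_pow]
  exact pow_le_pow_left₀ (norm_nonneg _) h 2

lemma dk_norm_le {m n : ℕ} (A : Matrix (Fin m) (Fin n) ℝ) (s : ℝ) (hs : 0 ≤ s)
    (h : ∀ x, (A *ᵥ x) ⬝ᵥ (A *ᵥ x) ≤ s ^ 2 * (x ⬝ᵥ x)) : ‖A‖ ≤ s := by
  rw [Matrix.l2_opNorm_def]
  refine ContinuousLinearMap.opNorm_le_bound _ hs fun x => ?_
  have h1 := h x.ofLp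
  rw [← dk_nsq, ← dk_nsq, ← mul_pow] at h1
  exact (pow_le_pow_iff_left₀ (norm_nonneg _) (by positivity) two_ne_zero).1 h1

lemma dk_cs {m : ℕ} (x y : Fin m → ℝ) : (x ⬝ᵥ y) ^ 2 ≤ (x ⬝ᵥ x) * (y ⬝ᵥ y) := by
  have := Finset.sum_mul_sq_le_sq_mul_sq Finset.univ x y
  simpa [dotProduct, sq] using this

lemma dk_nonneg {m : ℕ} (x : Fin m → ℝ) : 0 ≤ x ⬝ᵥ x := by
  rw [← dk_nsq]; positivity

lemma dk_pos {m : ℕ} (x : Fin m → ℝ) (hx : x ≠ 0) : 0 < x ⬝ᵥ x :=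
  lt_of_le_of_ne (dk_nonneg x) fun h => hx (dotProduct_self_eq_zero.1 h.symm)

lemma dk_adj {m n : ℕ} (A : Matrix (Fin m) (Fin n) ℝ) (x : Fin m → ℝ) (y : Fin n → ℝ) :
    x ⬝ᵥ (A *ᵥ y) = (Aᵀ *ᵥ x) ⬝ᵥ y := by
  rw [dotProduct_mulVec, mulVec_transpose]

lemma dk_iso {m n : ℕ} (V : Matrix (Fin m) (Fin n) ℝ) (hV : Vᵀ * V = 1) (x y : Fin n → ℝ) :
    (V *ᵥ x) ⬝ᵥ (V *ᵥ y) = x ⬝ᵥ y := by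
  rw [dk_adj, mulVec_mulVec, hV, one_mulVec]

lemma dk_iso_norm {m n : ℕ} (V : Matrix (Fin m) (Fin n) ℝ) (hV : Vᵀ * V = 1) : ‖V‖ ≤ 1 :=
  dk_norm_le V 1 zero_le_one fun x => by rw [dk_iso V hV]; simp

lemma dk_norm_T {m n : ℕ} (V : Matrix (Fin m) (Fin n) ℝ) : ‖Vᵀ‖ = ‖V‖ := by
  rw [← Matrix.l2_opNorm_conjTranspose V, conjTranspose_eq_transpose_of_trivial]

lemma dk_quad {m : ℕ} (E : Matrix (Fin m) (Fin m) ℝ) (x : Fin m → ℝ) :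
    x ⬝ᵥ (E *ᵥ x) ≤ ‖E‖ * (x ⬝ᵥ x) := by
  refine abs_le_of_sq_le_sq' ?_ (mul_nonneg (norm_nonneg _) (dk_nonneg x)) |>.2
  have h1 := dk_cs x (E *ᵥ x)
  have h2 := dk_mulVec_le E x
  have h3 := mul_le_mul_of_nonneg_left h2 (dk_nonneg x)
  nlinarith

lemma dk_diagquad {n : ℕ} (U : Matrix (Fin n) (Fin n) ℝ) (μ : Fin n → ℝ) (x : Fin n → ℝ) :
    x ⬝ᵥ ((U * diagonal μ * Uᵀ) *ᵥ x) = ∑ i, μ i * (Uᵀ *ᵥ x) i ^ 2 := by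
  rw [← mulVec_mulVec, ← mulVec_mulVec, dk_adj]
  simp only [dotProduct, mulVec_diagonal]
  exact Finset.sum_congr rfl fun i _ => by ring

lemma dk_weyl {n : ℕ} (A B : Matrix (Fin n) (Fin n) ℝ)
    (μ : Fin n → ℝ) (hμ : Antitone μ) (U : Matrix (Fin n) (Fin n) ℝ) (hU : U * Uᵀ = 1)
    (hA : A = U * diagonal μ * Uᵀ)
    (ν : Fin n → ℝ) (hν : Antitone ν) (W : Matrix (Fin n) (Fin n) ℝ) (hW : W * Wᵀ = 1)
    (hB : B = W * diagonal ν * Wᵀ) (k : Fin n) : ν k ≤ μ k + ‖B - A‖ := by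
  have hU' : Uᵀᵀ * Uᵀ = 1 := by simpa using hU
  have hW' : Wᵀᵀ * Wᵀ = 1 := by simpa using hW
  let M : Matrix (Fin n) (Fin n) ℝ := Matrix.of fun i j =>
    if i = k then 0 else if k < i then Wᵀ i j else Uᵀ i j
  have hM : M.det = 0 := Matrix.det_eq_zero_of_row_eq_zero k fun j => by simp [M]
  obtain ⟨x, hx0, hx⟩ := Matrix.exists_mulVec_eq_zero_iff.2 hM
  have h1 : ∀ i, k < i → (Wᵀ *ᵥ x) i = 0 := fun i hi => by
    have := congrFun hx i
    simpa [M, mulVec, dotProduct, hi, hi.ne'] using this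
  have h2 : ∀ i, i < k → (Uᵀ *ᵥ x) i = 0 := fun i hi => by
    have := congrFun hx i
    simpa [M, mulVec, dotProduct, hi.le.not_gt, hi.ne] using this
  have e1 : ν k * (x ⬝ᵥ x) ≤ x ⬝ᵥ (B *ᵥ x) := by
    rw [hB, dk_diagquad, ← dk_iso Wᵀ hW' x x, dotProduct, Finset.mul_sum]
    refine Finset.sum_le_sum fun i _ => ?_
    rcases lt_or_ge k i with h | h
    · simp [h1 i h]
    · have := hν h
      nlinarith [sq_nonneg ((Wᵀ *ᵥ x) i)]
  have e2 : x ⬝ᵥ (A *ᵥ x) ≤ μ k * (x ⬝ᵥ x) := by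
    rw [hA, dk_diagquad, ← dk_iso Uᵀ hU' x x, dotProduct, Finset.mul_sum]
    refine Finset.sum_le_sum fun i _ => ?_
    rcases lt_or_ge i k with h | h
    · simp [h2 i h]
    · have := hμ h
      nlinarith [sq_nonneg ((Uᵀ *ᵥ x) i)]
  have e3 := dk_quad (B - A) x
  rw [sub_mulVec, dotProduct_sub] at e3
  have := dk_pos x hx0
  by_contra hc
  push Not at hc
  nlinarith

/-- the projection on the top eigenspace -/
lemma dk_proj {n r : ℕ} (hrn : r < n) (B : Matrix (Fin n) (Fin n) ℝ)
    (ν : Fin n → ℝ) (W : Matrix (Fin n) (Fin n) ℝ) (hW : W * Wᵀ = 1)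
    (hB : B = W * diagonal ν * Wᵀ)
    (hgap : ∀ i j : Fin n, i.1 < r → r ≤ j.1 → ν j < ν i)
    (V : Matrix (Fin n) (Fin r) ℝ) (hV : Vᵀ * V = 1)
    (hVB : B * V = V * diagonal fun j : Fin r => ν (Fin.castLE hrn.le j)) :
    V * Vᵀ = W * diagonal (fun i : Fin n => if i.1 < r then (1 : ℝ) else 0) * Wᵀ := by
  have hW2 : Wᵀ * W = 1 := mul_eq_one_comm.1 hW
  set Z := Wᵀ * V with hZ
  have hVZ : V = W * Z := by rw [hZ, ← Matrix.mul_assoc, hW, Matrix.one_mul]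
  have hZZ : Zᵀ * Z = 1 := by
    rw [hZ, transpose_mul, transpose_transpose, Matrix.mul_assoc, ← Matrix.mul_assoc W, hW,
      Matrix.one_mul, hV]
  have hdZ : diagonal ν * Z = Z * diagonal fun j : Fin r => ν (Fin.castLE hrn.le j) := by
    rw [hZ, Matrix.mul_assoc, ← hVB, hB]
    simp only [← Matrix.mul_assoc]
    rw [hW2, Matrix.one_mul]
  have hz : ∀ (i : Fin n) (j : Fin r), r ≤ i.1 → Z i j = 0 := fun i j hi => by
    have h := congrFun (congrFun hdZ i) j
    rw [diagonal_mul, mul_diagonal] at h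
    have hg := hgap (Fin.castLE hrn.le j) i j.2 hi
    have : (ν (Fin.castLE hrn.le j) - ν i) * Z i j = 0 := by linarith
    rcases mul_eq_zero.1 this with h | h
    · linarith
    · exact h
  -- square part
  let S : Matrix (Fin r) (Fin r) ℝ := Z.submatrix (Fin.castLE hrn.le) id
  have hS : Sᵀ * S = 1 := by
    rw [← hZZ]
    ext a b
    simp only [mul_apply, transpose_apply, S, submatrix_apply, id]
    have : ∀ f : Fin n → ℝ, (∀ i : Fin n, r ≤ i.1 → f i = 0) →
        ∑ i : Fin r, f (Fin.castLE hrn.le i) = ∑ i, f i := fun f hf => by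
      refine Finset.sum_of_injOn (Fin.castLE hrn.le) ((Fin.castLE_injective hrn.le).injOn) (by simp) ?_ (by simp)
      intro i _ hi
      apply hf
      by_contra hc
      push Not at hc
      exact hi ⟨⟨i, hc⟩, by simp, by ext; simp⟩
    exact this (fun i => Z i a * Z i b) fun i hi => by simp [hz i a hi]
  have hS' : S * Sᵀ = 1 := mul_eq_one_comm.1 hS
  have hD : Z * Zᵀ = diagonal (fun i : Fin n => if i.1 < r then (1 : ℝ) else 0) := by
    ext i j
    by_cases hi : i.1 < r
    · by_cases hj : j.1 < r
      · have := congrFun (congrFun hS' ⟨i, hi⟩) ⟨j, hj⟩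
        simp only [mul_apply, transpose_apply, S, submatrix_apply, id] at this ⊢
        refine this.trans ?_
        simp [one_apply, diagonal_apply, hi, Fin.ext_iff]
      · have hij : i ≠ j := fun h => hj (h ▸ hi)
        simp [mul_apply, diagonal_apply, hij, hz j _ (not_lt.1 hj)]
    · simp [mul_apply, diagonal_apply, hi, hz i _ (not_lt.1 hi)]
  rw [← hD, hVZ, transpose_mul]
  simp only [Matrix.mul_assoc]

/-- Pythagoras for a projection -/
lemma dk_pyth {n r : ℕ} (V : Matrix (Fin n) (Fin r) ℝ) (hV : Vᵀ * V = 1) (x : Fin n → ℝ) :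
    ((1 - V * Vᵀ) *ᵥ x) ⬝ᵥ ((1 - V * Vᵀ) *ᵥ x) = x ⬝ᵥ x - (Vᵀ *ᵥ x) ⬝ᵥ (Vᵀ *ᵥ x) := by
  rw [sub_mulVec, one_mulVec, ← mulVec_mulVec]
  simp only [sub_dotProduct, dotProduct_sub]
  rw [dk_iso V hV, dk_adj, dotProduct_comm (V *ᵥ _) x, dk_adj]
  ring

lemma dk_swap {n r : ℕ} (V W : Matrix (Fin n) (Fin r) ℝ) (hV : Vᵀ * V = 1) (hW : Wᵀ * W = 1) :
    ‖(1 - V * Vᵀ) * W‖ ≤ ‖(1 - W * Wᵀ) * V‖ := by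
  set s := ‖(1 - W * Wᵀ) * V‖ with hs
  have hs0 : 0 ≤ s := norm_nonneg _
  have key : ∀ y, (1 - s ^ 2) * (y ⬝ᵥ y) ≤ ((Wᵀ * V) *ᵥ y) ⬝ᵥ ((Wᵀ * V) *ᵥ y) := fun y => by
    have h := dk_mulVec_le ((1 - W * Wᵀ) * V) y
    rw [← mulVec_mulVec, dk_pyth W hW, dk_iso V hV, ← hs, mulVec_mulVec] at h
    linarith
  refine dk_norm_le _ s hs0 fun x => ?_
  rw [← mulVec_mulVec, dk_pyth V hV, dk_iso W hW, mulVec_mulVec]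
  rcases le_or_gt 1 s with h1 | h1
  · have := dk_nonneg x
    have := dk_nonneg ((Vᵀ * W) *ᵥ x)
    nlinarith [mul_le_mul h1 h1 zero_le_one hs0]
  have hp : 0 < 1 - s ^ 2 := by nlinarith
  set T := Wᵀ * V with hT
  have hTT : Vᵀ * W = Tᵀ := by simp [hT]
  have hdet : T.det ≠ 0 := fun h => by
    obtain ⟨y, hy0, hy⟩ := Matrix.exists_mulVec_eq_zero_iff.2 h
    have := key y
    rw [hy] at this
    have h2 := dk_pos y hy0
    simp at this
    nlinarith
  obtain ⟨y, rfl⟩ : ∃ y, x = T *ᵥ y :=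
    ⟨T⁻¹ *ᵥ x, by rw [mulVec_mulVec, mul_nonsing_inv _ (isUnit_iff_ne_zero.2 hdet), one_mulVec]⟩
  rw [hTT]
  have hk := key y
  have hc := dk_cs (Tᵀ *ᵥ (T *ᵥ y)) y
  rw [← dk_adj] at hc
  set a := (T *ᵥ y) ⬝ᵥ (T *ᵥ y)
  set b := (Tᵀ *ᵥ (T *ᵥ y)) ⬝ᵥ (Tᵀ *ᵥ (T *ᵥ y))
  have ha : 0 ≤ a := dk_nonneg _
  have hb : 0 ≤ b := dk_nonneg _
  have h3 : (1 - s ^ 2) * a ^ 2 ≤ b * a := by nlinarith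
  rcases ha.eq_or_lt with h | h
  · rw [← h]; linarith
  · have : (1 - s ^ 2) * a ≤ b := le_of_mul_le_mul_right (by nlinarith) h
    linarith

lemma dk_projdiff {n r : ℕ} (V W : Matrix (Fin n) (Fin r) ℝ) (hV : Vᵀ * V = 1)
    (hW : Wᵀ * W = 1) : ‖V * Vᵀ - W * Wᵀ‖ ≤ ‖(1 - W * Wᵀ) * V‖ := by
  have hsw := dk_swap V W hV hW
  set s := ‖(1 - W * Wᵀ) * V‖ with hs
  have hs0 : 0 ≤ s := norm_nonneg _
  refine dk_norm_le _ s hs0 fun x => ?_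
  have hWs : (1 - W * Wᵀ) * (1 - W * Wᵀ) = 1 - W * Wᵀ := by
    have : W * Wᵀ * (W * Wᵀ) = W * Wᵀ := by
      rw [Matrix.mul_assoc, ← Matrix.mul_assoc Wᵀ, hW, Matrix.one_mul]
    rw [Matrix.mul_sub, Matrix.sub_mul, Matrix.sub_mul, this]; simp
  have hVV : Vᵀ * (1 - V * Vᵀ) = 0 := by
    rw [Matrix.mul_sub, ← Matrix.mul_assoc, hV]; simp
  set p := (1 - W * Wᵀ) *ᵥ x with hp
  set q := Wᵀ *ᵥ x with hq
  have hdec : (V * Vᵀ - W * Wᵀ) *ᵥ x = V *ᵥ (((1 - W * Wᵀ) * V)ᵀ *ᵥ p)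
      - ((1 - V * Vᵀ) * W) *ᵥ q := by
    have hT : ((1 - W * Wᵀ) * V)ᵀ = Vᵀ * (1 - W * Wᵀ) := by
      simp [transpose_mul]
    rw [hT, hp, hq, mulVec_mulVec, mulVec_mulVec, mulVec_mulVec, ← sub_mulVec]
    congr 1
    rw [Matrix.mul_assoc, Matrix.mul_assoc, hWs]
    simp only [Matrix.mul_sub, Matrix.sub_mul, Matrix.mul_one, Matrix.one_mul, Matrix.mul_assoc]
    abel
  have horth : (V *ᵥ (((1 - W * Wᵀ) * V)ᵀ *ᵥ p)) ⬝ᵥ (((1 - V * Vᵀ) * W) *ᵥ q) = 0 := by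
    rw [dotProduct_comm, dk_adj, mulVec_mulVec, ← Matrix.mul_assoc, hVV]
    simp
  have e1 := dk_mulVec_le ((1 - W * Wᵀ) * V)ᵀ p
  rw [dk_norm_T, ← hs] at e1
  have e2 := dk_mulVec_le ((1 - V * Vᵀ) * W) q
  have e3 : ‖(1 - V * Vᵀ) * W‖ ^ 2 ≤ s ^ 2 := pow_le_pow_left₀ (norm_nonneg _) hsw 2
  have e4 := mul_le_mul_of_nonneg_right e3 (dk_nonneg q)
  have e5 := dk_pyth W hW x
  rw [← hp, ← hq] at e5
  have e6 : ((V * Vᵀ - W * Wᵀ) *ᵥ x) ⬝ᵥ ((V * Vᵀ - W * Wᵀ) *ᵥ x) =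
      (((1 - W * Wᵀ) * V)ᵀ *ᵥ p) ⬝ᵥ (((1 - W * Wᵀ) * V)ᵀ *ᵥ p)
      + (((1 - V * Vᵀ) * W) *ᵥ q) ⬝ᵥ (((1 - V * Vᵀ) * W) *ᵥ q) := by
    rw [hdec]
    simp only [sub_dotProduct, dotProduct_sub]
    rw [horth, dotProduct_comm (((1 - V * Vᵀ) * W) *ᵥ q), horth, dk_iso V hV]
    ring
  rw [e6]
  have : x ⬝ᵥ x = p ⬝ᵥ p + q ⬝ᵥ q := by linarith
  rw [this]
  linarith

lemma dk_diag_norm {m : ℕ} (d : Fin m → ℝ) (s : ℝ) (hs : 0 ≤ s) (h : ∀ i, |d i| ≤ s) :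
    ‖(diagonal d : Matrix (Fin m) (Fin m) ℝ)‖ ≤ s := by
  rw [Matrix.l2_opNorm_diagonal]
  exact (pi_norm_le_iff_of_nonneg hs).2 h

/-- Davis–Kahan theorem, variant in which the separation hypothesis is replaced by
`‖Â − A‖₂ < δ_r / 2` where `δ_r = λ_r(A) − λ_{r+1}(A)` is the eigengap of `A`.
`μ` (resp. `μh`) lists the eigenvalues of the symmetric matrix `A` (resp. `Ahat`)
in decreasing order, and `V` (resp. `Vh`) is a top-`r` orthonormal eigenbasis. -/
theorem davis_kahan_gap_variant
    (n r : ℕ) (hr : 1 ≤ r) (hrn : r < n)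
    (A Ahat : Matrix (Fin n) (Fin n) ℝ) (hA : Aᵀ = A) (hAhat : Ahatᵀ = Ahat)
    (μ : Fin n → ℝ) (hμmono : Antitone μ)
    (U : Matrix (Fin n) (Fin n) ℝ) (hU : U * Uᵀ = 1)
    (hdecomp : A = U * Matrix.diagonal μ * Uᵀ)
    (μh : Fin n → ℝ) (hμhmono : Antitone μh)
    (Uh : Matrix (Fin n) (Fin n) ℝ) (hUh : Uh * Uhᵀ = 1)
    (hdecomph : Ahat = Uh * Matrix.diagonal μh * Uhᵀ)
    (δ : ℝ) (hδ : δ = μ ⟨r - 1, by omega⟩ - μ ⟨r, hrn⟩) (hδpos : 0 < δ)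
    (V : Matrix (Fin n) (Fin r) ℝ) (hV : Vᵀ * V = 1)
    (hVA : A * V = V * Matrix.diagonal fun j : Fin r => μ (Fin.castLE hrn.le j))
    (Vh : Matrix (Fin n) (Fin r) ℝ) (hVh : Vhᵀ * Vh = 1)
    (hVhA : Ahat * Vh = Vh * Matrix.diagonal fun j : Fin r => μh (Fin.castLE hrn.le j))
    (hE : sNorm (Ahat - A) < δ / 2) :
    sNorm (V * Vᵀ - Vh * Vhᵀ) ≤ 2 * sNorm ((Ahat - A) * V) / δ := by
  simp only [dk_sNorm_eq] at hE ⊢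
  have hUh2 : Uhᵀ * Uh = 1 := mul_eq_one_comm.1 hUh
  set r' : Fin n := ⟨r, hrn⟩ with hr'
  set r1 : Fin n := ⟨r - 1, by omega⟩ with hr1
  have w1 := dk_weyl A Ahat μ hμmono U hU hdecomp μh hμhmono Uh hUh hdecomph r'
  have w2 := dk_weyl Ahat A μh hμhmono Uh hUh hdecomph μ hμmono U hU hdecomp r1
  rw [norm_sub_rev] at w2
  have hgap : ∀ i j : Fin n, i.1 < r → r ≤ j.1 → μh j < μh i := fun i j hi hj => by
    have h1 : μh r1 ≤ μh i := hμhmono (by rw [Fin.le_def]; simp [hr1]; omega)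
    have h2 : μh j ≤ μh r' := hμhmono (by rw [Fin.le_def]; simpa [hr'] using hj)
    linarith
  have hQ := dk_proj hrn Ahat μh Uh hUh hdecomph hgap Vh hVh hVhA
  have hpd := dk_projdiff V Vh hV hVh
  refine hpd.trans ?_
  -- the shift
  obtain ⟨c, hc⟩ : ∃ c : ℝ, (∀ i, c ≤ μh i) ∧ c < μ r1 := by
    obtain ⟨c, hc⟩ := (Set.finite_range μh).bddBelow
    exact ⟨min c (μ r1 - 1), fun i => (min_le_left _ _).trans (hc ⟨i, rfl⟩),
      (min_le_right _ _).trans_lt (by linarith)⟩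
  obtain ⟨hc1, hc2⟩ := hc
  set R := 1 - Vh * Vhᵀ with hR
  set Y := R * V with hY
  set L : Fin r → ℝ := fun j => μ (Fin.castLE hrn.le j) with hL
  have hLge : ∀ j, μ r1 ≤ L j := fun j => hμmono (by rw [Fin.le_def]; simp [hr1]; omega)
  have hRd : R = Uh * diagonal (fun i : Fin n => if i.1 < r then (0 : ℝ) else 1) * Uhᵀ := by
    have : (diagonal (fun i : Fin n => if i.1 < r then (0 : ℝ) else 1))
        = 1 - diagonal (fun i : Fin n => if i.1 < r then (1 : ℝ) else 0) := by
      rw [← diagonal_one, diagonal_sub]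
      congr 1; ext i; split_ifs <;> simp
    rw [hR, hQ, this, Matrix.mul_sub, Matrix.sub_mul, Matrix.mul_one, hUh]
  have conj : ∀ d e : Fin n → ℝ, (Uh * diagonal d * Uhᵀ) * (Uh * diagonal e * Uhᵀ)
      = Uh * diagonal (fun i => d i * e i) * Uhᵀ := fun d e => by
    calc _ = Uh * diagonal d * (Uhᵀ * Uh) * diagonal e * Uhᵀ := by
          simp only [Matrix.mul_assoc]
      _ = _ := by rw [hUh2, Matrix.mul_one, Matrix.mul_assoc Uh, diagonal_mul_diagonal]
  have hRR : R * R = R := by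
    rw [hRd, conj]; congr 3; ext i; split_ifs <;> simp
  have hcomm : R * Ahat = Ahat * R := by
    rw [hRd, hdecomph, conj, conj]; congr 3; ext i; ring
  have hsh : Ahat - c • (1 : Matrix (Fin n) (Fin n) ℝ)
      = Uh * diagonal (fun i => μh i - c) * Uhᵀ := by
    have : diagonal (fun i => μh i - c) = diagonal μh - c • (1 : Matrix (Fin n) (Fin n) ℝ) := by
      rw [smul_one_eq_diagonal, diagonal_sub]
    rw [this, Matrix.mul_sub, Matrix.sub_mul, ← hdecomph, Matrix.mul_smul, Matrix.smul_mul,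
      Matrix.mul_one, hUh]
  have hUn : ‖Uh‖ ≤ 1 := dk_iso_norm Uh hUh2
  have hUtn : ‖Uhᵀ‖ ≤ 1 := by rw [dk_norm_T]; exact hUn
  have hRn : ‖R‖ ≤ 1 := by
    rw [hRd]
    refine (Matrix.l2_opNorm_mul _ _).trans (mul_le_one₀ ((Matrix.l2_opNorm_mul _ _).trans
      (mul_le_one₀ hUn (norm_nonneg _) ?_)) (norm_nonneg _) hUtn)
    exact dk_diag_norm _ _ zero_le_one fun i => by split_ifs <;> simp
  have hbc : 0 ≤ μh r' - c := by linarith [hc1 r']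
  have hBn : ‖(Ahat - c • (1 : Matrix (Fin n) (Fin n) ℝ)) * R‖ ≤ μh r' - c := by
    rw [hsh, hRd, conj]
    have hd : ‖(diagonal fun i : Fin n => (μh i - c) * if i.1 < r then (0 : ℝ) else 1)‖
        ≤ μh r' - c := by
      refine dk_diag_norm _ _ hbc fun i => ?_
      split_ifs with h
      · simpa using hbc
      · have h2 : μh i ≤ μh r' := hμhmono (by rw [Fin.le_def]; simp [hr']; omega)
        rw [mul_one, abs_of_nonneg (by linarith [hc1 i])]
        linarith
    calc _ ≤ ‖Uh‖ * ‖(diagonal fun i : Fin n => (μh i - c) * if i.1 < r then (0 : ℝ) else 1)‖ * ‖Uhᵀ‖ :=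
          (Matrix.l2_opNorm_mul _ _).trans
            (mul_le_mul_of_nonneg_right (Matrix.l2_opNorm_mul _ _) (norm_nonneg _))
      _ ≤ 1 * (μh r' - c) * 1 := by gcongr
      _ = _ := by ring
  have hRY : R * Y = Y := by rw [hY, ← Matrix.mul_assoc, hRR]
  have hsyl : Y * diagonal (fun j => L j - c)
      = ((Ahat - c • (1 : Matrix (Fin n) (Fin n) ℝ)) * R) * Y - R * ((Ahat - A) * V) := by
    have h1 : diagonal (fun j => L j - c) = diagonal L - c • (1 : Matrix (Fin r) (Fin r) ℝ) := by
      rw [smul_one_eq_diagonal, diagonal_sub]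
    have h2 : R * (Ahat * V) = Ahat * Y := by rw [← Matrix.mul_assoc, hcomm, Matrix.mul_assoc]
    rw [h1, Matrix.mul_assoc _ R Y, hRY, Matrix.sub_mul Ahat A, Matrix.mul_sub R, h2, hVA,
      Matrix.mul_sub, Matrix.sub_mul, ← Matrix.mul_assoc R V, ← hY]
    simp
  have hinv : Y = Y * diagonal (fun j => L j - c) * diagonal (fun j => (L j - c)⁻¹) := by
    rw [Matrix.mul_assoc, diagonal_mul_diagonal]
    have : (fun j => (L j - c) * (L j - c)⁻¹) = fun _ => (1 : ℝ) := by
      ext j; exact mul_inv_cancel₀ (by linarith [hLge j])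
    rw [this, diagonal_one, Matrix.mul_one]
  have hac : 0 < μ r1 - c := by linarith
  have hin : ‖(diagonal fun j => (L j - c)⁻¹)‖ ≤ (μ r1 - c)⁻¹ := by
    refine dk_diag_norm _ _ (inv_nonneg.2 hac.le) fun j => ?_
    have := hLge j
    rw [abs_of_nonneg (inv_nonneg.2 (by linarith))]
    exact inv_anti₀ hac (by linarith)
  have f1 : ‖Y‖ ≤ ‖Y * diagonal (fun j => L j - c)‖ * (μ r1 - c)⁻¹ := by
    conv_lhs => rw [hinv]
    exact (Matrix.l2_opNorm_mul _ _).trans (mul_le_mul_of_nonneg_left hin (norm_nonneg _))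
  have f2 : ‖Y * diagonal (fun j => L j - c)‖ ≤ (μh r' - c) * ‖Y‖ + ‖(Ahat - A) * V‖ := by
    rw [hsyl]
    refine (norm_sub_le _ _).trans (add_le_add ?_ ?_)
    · exact (Matrix.l2_opNorm_mul _ _).trans (mul_le_mul_of_nonneg_right hBn (norm_nonneg _))
    · exact (Matrix.l2_opNorm_mul _ _).trans (mul_le_of_le_one_left (norm_nonneg _) hRn)
  rw [← div_eq_mul_inv, le_div_iff₀ hac] at f1
  rw [le_div_iff₀ hδpos]
  have hY0 : 0 ≤ ‖Y‖ := norm_nonneg _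
  have hg2 : δ / 2 ≤ μ r1 - μh r' := by linarith
  nlinarith [mul_le_mul_of_nonneg_left hg2 hY0]
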